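/- arXiv:2309.01752 — 8 statements merged into one kernel-verified Lean document; each statement's English description precedes it below -/
import Mathlib

section
/- Let F be the free group on x, y, z, let r₁ = z⁻²x⁻¹(y⁻¹z²yx⁻¹y⁻¹z²)²yx⁻¹z⁻²y and r₂ = z⁻²(yx⁻¹y⁻¹z²)²xz²x⁻¹(z⁻²yxy⁻¹)², let μ = z(yx⁻¹y⁻¹z²)²x, λ = x⁻¹(z⁻²yxy⁻¹)²(yx⁻¹y⁻¹z²)²xz², and s_k = μλᵏ for an integer k ≥ 0. Let D_x, D_y, D_z : F → ℤ[F] be Fox derivatives with respect to x, y, z respectively, and let Φ : ℤ[F] → ℤ[t,t⁻¹] be the ring homomorphism induced by the group homomorphism φ : F → (ℤ[t,t⁻¹])ˣ with φ(x) = −1, φ(y) = −t, φ(z) = −1. Then for every integer k ≥ 0, every 2×2 minor of the 3×3 matrix over ℤ[t,t⁻¹] whose (i,j) entry is Φ(D_{g_j}(ρ_i)), where (ρ₁, ρ₂, ρ₃) = (r₁, r₂, s_k) and (g₁, g₂, g₃) = (x, y, z), is equal to zero. (This is the formal content of the Main Theorem: the taut polynomial of the veering triangulation V_k, computed as the twisted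 Alexander polynomial of the presentation ⟨x,y,z | r₁, r₂, s_k⟩ of π₁(M_k), vanishes for every k ≥ 0.) -/
open LaurentPolynomial

/-- The free group on three generators `x`, `y`, `z`. -/
abbrev F : Type := FreeGroup (Fin 3)

def x : F := FreeGroup.of 0
def y : F := FreeGroup.of 1
def z : F := FreeGroup.of 2

/-- r₁ = z⁻²x⁻¹(y⁻¹z²yx⁻¹y⁻¹z²)²yx⁻¹z⁻²y -/
def r₁ : F :=
  (z ^ 2)⁻¹ * x⁻¹ * (y⁻¹ * z ^ 2 * y * x⁻¹ * y⁻¹ * z ^ 2) ^ 2 * y * x⁻¹ * (z ^ 2)⁻¹ * y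

/-- r₂ = z⁻²(yx⁻¹y⁻¹z²)²xz²x⁻¹(z⁻²yxy⁻¹)² -/
def r₂ : F :=
  (z ^ 2)⁻¹ * (y * x⁻¹ * y⁻¹ * z ^ 2) ^ 2 * x * z ^ 2 * x⁻¹ * ((z ^ 2)⁻¹ * y * x * y⁻¹) ^ 2

/-- μ = z(yx⁻¹y⁻¹z²)²x -/
def μ : F := z * (y * x⁻¹ * y⁻¹ * z ^ 2) ^ 2 * x

/-- λ = x⁻¹(z⁻²yxy⁻¹)²(yx⁻¹y⁻¹z²)²xz² -/
def lam : F :=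
  x⁻¹ * ((z ^ 2)⁻¹ * y * x * y⁻¹) ^ 2 * (y * x⁻¹ * y⁻¹ * z ^ 2) ^ 2 * x * z ^ 2

/-- s_k = μλᵏ -/
def s (k : ℕ) : F := μ * lam ^ k

section CrossedHom

variable {G R : Type*} [Group G] [CommRing R] {χ : G →* R} {d : G → R}

lemma crossedHom_one (hd : ∀ u v, d (u * v) = d u + χ u * d v) : d 1 = 0 := by
  simpa using hd 1 1

lemma crossedHom_inv (hd : ∀ u v, d (u * v) = d u + χ u * d v) (u : G) :
    d u⁻¹ = -(χ u⁻¹ * d u) := by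
  have h := hd u⁻¹ u
  rw [inv_mul_cancel, crossedHom_one hd] at h
  linear_combination -h

lemma crossedHom_sq (hd : ∀ u v, d (u * v) = d u + χ u * d v) (u : G) :
    d (u ^ 2) = (1 + χ u) * d u := by
  rw [pow_two, hd]
  ring

lemma map_inv_of_map_eq_neg_one {u : G} (hu : χ u = -1) : χ u⁻¹ = -1 := by
  have h : χ u * χ u⁻¹ = 1 := by rw [← map_mul, mul_inv_cancel, map_one]
  rw [hu] at h
  linear_combination -h

end CrossedHom

section Relators

variable {R : Type*} [CommRing R] {χ : F →* R} {d : F → R}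

lemma crossedHom_r₁ (hd : ∀ u v, d (u * v) = d u + χ u * d v)
    (hx : χ x = -1) (hz : χ z = -1) : d r₁ = 0 := by
  have hx' := map_inv_of_map_eq_neg_one hx
  have hz' := map_inv_of_map_eq_neg_one hz
  have hy : χ y * χ y⁻¹ = 1 := by rw [← map_mul, mul_inv_cancel, map_one]
  simp only [r₁, hd, crossedHom_sq hd, crossedHom_inv hd, map_mul, map_pow, ← inv_pow,
    hx', hz, hz']
  generalize χ y⁻¹ = v at *
  generalize χ y = t at *
  grind

lemma crossedHom_r₂ (hd : ∀ u v, d (u * v) = d u + χ u * d v)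
    (hx : χ x = -1) (hz : χ z = -1) : d r₂ = 0 := by
  have hx' := map_inv_of_map_eq_neg_one hx
  have hz' := map_inv_of_map_eq_neg_one hz
  have hy : χ y * χ y⁻¹ = 1 := by rw [← map_mul, mul_inv_cancel, map_one]
  simp only [r₂, hd, crossedHom_sq hd, crossedHom_inv hd, map_mul, map_pow, ← inv_pow,
    hx, hx', hz, hz']
  generalize χ y⁻¹ = v at *
  generalize χ y = t at *
  grind

end Relators

/-- Main Theorem: for every integer `k ≥ 0`, every 2×2 minor of the 3×3
matrix over `ℤ[t,t⁻¹]` whose `(i,j)` entry is `Φ(D_{g_j}(ρ_i))`, where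
`(ρ₁, ρ₂, ρ₃) = (r₁, r₂, s_k)` and `(g₁, g₂, g₃) = (x, y, z)`, `D_x, D_y, D_z` are the
Fox derivatives, and `Φ : ℤ[F] → ℤ[t,t⁻¹]` is induced by `x ↦ -1`, `y ↦ -t`, `z ↦ -1`,
is equal to zero. -/
theorem taut_polynomial_vanishes (k : ℕ)
    (Dx Dy Dz : F → MonoidAlgebra ℤ F)
    (hDx₁ : Dx x = 1) (hDx₂ : Dx y = 0) (hDx₃ : Dx z = 0)
    (hDx : ∀ u v : F, Dx (u * v) = Dx u + MonoidAlgebra.of ℤ F u * Dx v)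
    (hDy₁ : Dy y = 1) (hDy₂ : Dy x = 0) (hDy₃ : Dy z = 0)
    (hDy : ∀ u v : F, Dy (u * v) = Dy u + MonoidAlgebra.of ℤ F u * Dy v)
    (hDz₁ : Dz z = 1) (hDz₂ : Dz x = 0) (hDz₃ : Dz y = 0)
    (hDz : ∀ u v : F, Dz (u * v) = Dz u + MonoidAlgebra.of ℤ F u * Dz v)
    (Φ : MonoidAlgebra ℤ F →+* LaurentPolynomial ℤ)
    (hΦx : Φ (MonoidAlgebra.of ℤ F x) = -1)
    (hΦy : Φ (MonoidAlgebra.of ℤ F y) = -(T 1))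
    (hΦz : Φ (MonoidAlgebra.of ℤ F z) = -1) :
    ∀ rows cols : Fin 2 → Fin 3,
      (((Matrix.of fun i j : Fin 3 =>
          Φ ((![Dx, Dy, Dz] j) (![r₁, r₂, s k] i)))).submatrix rows cols).det = 0 := by
  intro rows cols
  let χ : F →* LaurentPolynomial ℤ := (Φ : MonoidAlgebra ℤ F →* LaurentPolynomial ℤ).comp
    (MonoidAlgebra.of ℤ F)
  have crossed (D : F → MonoidAlgebra ℤ F)
      (hD : ∀ u v : F, D (u * v) = D u + MonoidAlgebra.of ℤ F u * D v) :
      Φ (D r₁) = 0 ∧ Φ (D r₂) = 0 := by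
    have hd (u v : F) : Φ (D (u * v)) = Φ (D u) + χ u * Φ (D v) := by
      rw [hD, map_add, map_mul]
      rfl
    exact ⟨crossedHom_r₁ (d := fun u => Φ (D u)) hd hΦx hΦz,
      crossedHom_r₂ (d := fun u => Φ (D u)) hd hΦx hΦz⟩
  have row_zero (i j : Fin 3) (hi : i ≠ 2) :
      Φ ((![Dx, Dy, Dz] j) (![r₁, r₂, s k] i)) = 0 := by
    fin_cases i <;> fin_cases j <;> first | exact absurd rfl hi | simp [*]
  by_cases h₀ : rows 0 = 2
  · by_cases h₁ : rows 1 = 2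
    · exact Matrix.det_zero_of_row_eq (i := 0) (j := 1) (by decide) (by ext j; simp [h₀, h₁])
    · exact Matrix.det_eq_zero_of_row_eq_zero 1 fun j => row_zero _ _ h₁
  · exact Matrix.det_eq_zero_of_row_eq_zero 0 fun j => row_zero _ _ h₀
end

section
/- Let F be the free group on x, y, z and let r₁ = z⁻²x⁻¹(y⁻¹z²yx⁻¹y⁻¹z²)²yx⁻¹z⁻²y, r₂ = z⁻²(yx⁻¹y⁻¹z²)²xz²x⁻¹(z⁻²yxy⁻¹)² ∈ F. If D : F → ℤ[F] is a Fox derivative with respect to x (i.e. D(x) = 1, D(y) = D(z) = 0, and D(uv) = D(u) + u·D(v) for all u, v ∈ F), and Φ : ℤ[F] → ℤ[t,t⁻¹] is the ring homomorphism induced by x ↦ −1, y ↦ −t, z ↦ −1, then Φ(D(r₁)) = 0 and Φ(D(r₂)) = 0. -/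
open LaurentPolynomial

/-- A crossed homomorphism `f` along `g` satisfies `f u⁻¹ = -g u⁻¹ * f u`. -/
theorem crossedHom_inv_s1 {G R : Type*} [Group G] [Ring R] (g : G →* R) (f : G → R)
    (hf : ∀ u v, f (u * v) = f u + g u * f v) (u : G) : f u⁻¹ = -(g u⁻¹ * f u) := by
  have h_one : f 1 = 0 := by simpa using hf 1 1
  have h := hf u⁻¹ u
  rw [inv_mul_cancel, h_one] at h
  exact eq_neg_of_add_eq_zero_left h.symm

/-- A monoid homomorphism from a group sends `u⁻¹` to any left inverse of the image of `u`. -/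
theorem map_inv_eq_of_mul_eq_one {G R : Type*} [Group G] [Monoid R] (g : G →* R) {u : G} {a b : R}
    (hu : g u = a) (hab : b * a = 1) : g u⁻¹ = b := by
  refine (left_inv_eq_right_inv hab ?_).symm
  rw [← hu, ← map_mul, mul_inv_cancel, map_one]

/-- if `D` is the Fox derivative with respect to `x` and `Φ` is the ring
homomorphism `ℤ[F] → ℤ[t,t⁻¹]` induced by `x ↦ -1`, `y ↦ -t`, `z ↦ -1`, then
`Φ(D(r₁)) = 0` and `Φ(D(r₂)) = 0`. -/
theorem fox_derivative_x_vanishes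
    (D : F → MonoidAlgebra ℤ F)
    (hDx : D x = 1) (hDy : D y = 0) (hDz : D z = 0)
    (hD : ∀ u v : F, D (u * v) = D u + MonoidAlgebra.of ℤ F u * D v)
    (Φ : MonoidAlgebra ℤ F →+* LaurentPolynomial ℤ)
    (hΦx : Φ (MonoidAlgebra.of ℤ F x) = -1)
    (hΦy : Φ (MonoidAlgebra.of ℤ F y) = -(T 1))
    (hΦz : Φ (MonoidAlgebra.of ℤ F z) = -1) :
    Φ (D r₁) = 0 ∧ Φ (D r₂) = 0 := by
  let g : F →* LaurentPolynomial ℤ := (Φ : _ →* _).comp (MonoidAlgebra.of ℤ F)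
  obtain ⟨f, hf⟩ : ∃ f : F → LaurentPolynomial ℤ, ∀ u, f u = Φ (D u) := ⟨_, fun _ => rfl⟩
  have hmul : ∀ u v, f (u * v) = f u + g u * f v := fun u v => by
    simp only [hf, hD, map_add, map_mul]
    rfl
  have hinv := crossedHom_inv_s1 g f hmul
  have hfx : f x = 1 := by rw [hf, hDx, map_one]
  have hfy : f y = 0 := by rw [hf, hDy, map_zero]
  have hfz : f z = 0 := by rw [hf, hDz, map_zero]
  have hgx : g x = -1 := hΦx
  have hgy : g y = -T 1 := hΦy
  have hgz : g z = -1 := hΦz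
  have hT : (T (-1) * T 1 : LaurentPolynomial ℤ) = 1 := by rw [← T_add]; simp
  have hgx' : g x⁻¹ = -1 := map_inv_eq_of_mul_eq_one g hgx (by ring)
  have hgy' : g y⁻¹ = -T (-1) := map_inv_eq_of_mul_eq_one g hgy (by rw [neg_mul_neg, hT])
  have hgz' : g z⁻¹ = -1 := map_inv_eq_of_mul_eq_one g hgz (by ring)
  clear_value g
  rw [← hf, ← hf]
  constructor
  · simp only [r₁, pow_two, mul_inv_rev, hmul, hinv, map_mul, hfx, hfy, hfz, hgy, hgz,
      hgx', hgy', hgz']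
    generalize (T (-1) : LaurentPolynomial ℤ) = a at *
    generalize (T 1 : LaurentPolynomial ℤ) = b at *
    grind
  · simp only [r₂, pow_two, mul_inv_rev, hmul, hinv, map_mul, hfx, hfy, hfz, hgx, hgy, hgz,
      hgx', hgy', hgz']
    generalize (T (-1) : LaurentPolynomial ℤ) = a at *
    generalize (T 1 : LaurentPolynomial ℤ) = b at *
    grind
end

section
/- Let F be the free group on x, y, z and let r₁ = z⁻²x⁻¹(y⁻¹z²yx⁻¹y⁻¹z²)²yx⁻¹z⁻²y, r₂ = z⁻²(yx⁻¹y⁻¹z²)²xz²x⁻¹(z⁻²yxy⁻¹)² ∈ F. If D : F → ℤ[F] is a Fox derivative with respect to z (i.e. D(z) = 1, D(x) = D(y) = 0, and D(uv) = D(u) + u·D(v) for all u, v ∈ F), and Φ : ℤ[F] → ℤ[t,t⁻¹] is the ring homomorphism induced by x ↦ −1, y ↦ −t, z ↦ −1, then Φ(D(r₁)) = 0 and Φ(D(r₂)) = 0. -/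
open LaurentPolynomial

/-- The elements on which a crossed homomorphism `D : G → ℤ[G]` vanishes after applying a ring
homomorphism `Φ` form a subgroup. -/
def crossedHomKer {G R : Type*} [Group G] [Ring R] (D : G → MonoidAlgebra ℤ G)
    (hD : ∀ u v : G, D (u * v) = D u + MonoidAlgebra.of ℤ G u * D v)
    (Φ : MonoidAlgebra ℤ G →+* R) : Subgroup G where
  carrier := {u | Φ (D u) = 0}
  one_mem' := by
    have h := hD 1 1
    rw [mul_one, map_one, one_mul, left_eq_add] at h
    simp [h]
  mul_mem' {u v} hu hv := by
    simp only [Set.mem_ofPred_eq] at hu hv ⊢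
    rw [hD, map_add, map_mul, hu, hv, mul_zero, add_zero]
  inv_mem' {u} hu := by
    simp only [Set.mem_ofPred_eq] at hu ⊢
    have h := hD u⁻¹ u
    have h₁ := hD 1 1
    rw [mul_one, map_one, one_mul, left_eq_add] at h₁
    rw [inv_mul_cancel, h₁] at h
    simpa [hu] using (congrArg Φ h).symm

theorem mem_crossedHomKer {G R : Type*} [Group G] [Ring R] {D : G → MonoidAlgebra ℤ G}
    {hD : ∀ u v : G, D (u * v) = D u + MonoidAlgebra.of ℤ G u * D v}
    {Φ : MonoidAlgebra ℤ G →+* R} {u : G} : u ∈ crossedHomKer D hD Φ ↔ Φ (D u) = 0 :=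
  Iff.rfl

/-- if `D` is the Fox derivative with respect to `z` and `Φ` is the ring
homomorphism `ℤ[F] → ℤ[t,t⁻¹]` induced by `x ↦ -1`, `y ↦ -t`, `z ↦ -1`, then
`Φ(D(r₁)) = 0` and `Φ(D(r₂)) = 0`. -/
theorem fox_derivative_z_vanishes
    (D : F → MonoidAlgebra ℤ F)
    (hDz : D z = 1) (hDx : D x = 0) (hDy : D y = 0)
    (hD : ∀ u v : F, D (u * v) = D u + MonoidAlgebra.of ℤ F u * D v)
    (Φ : MonoidAlgebra ℤ F →+* LaurentPolynomial ℤ)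
    (hΦx : Φ (MonoidAlgebra.of ℤ F x) = -1)
    (hΦy : Φ (MonoidAlgebra.of ℤ F y) = -(T 1))
    (hΦz : Φ (MonoidAlgebra.of ℤ F z) = -1) :
    Φ (D r₁) = 0 ∧ Φ (D r₂) = 0 := by
  have hx : x ∈ crossedHomKer D hD Φ := by simp [mem_crossedHomKer, hDx]
  have hy : y ∈ crossedHomKer D hD Φ := by simp [mem_crossedHomKer, hDy]
  have hz : z ^ 2 ∈ crossedHomKer D hD Φ := by
    rw [mem_crossedHomKer, pow_two, hD, hDz, mul_one, map_add, map_one, hΦz, add_neg_cancel]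
  have hx' := inv_mem hx
  have hy' := inv_mem hy
  have hz' := inv_mem hz
  rw [← mem_crossedHomKer (hD := hD), ← mem_crossedHomKer (hD := hD)]
  constructor
  · unfold r₁
    repeat' first | assumption | apply mul_mem | apply pow_mem
  · unfold r₂
    repeat' first | assumption | apply mul_mem | apply pow_mem
end

section
/- Let F be the free group on x, y, z, let r₁ = z⁻²x⁻¹(y⁻¹z²yx⁻¹y⁻¹z²)²yx⁻¹z⁻²y and r₂ = z⁻²(yx⁻¹y⁻¹z²)²xz²x⁻¹(z⁻²yxy⁻¹)², and let G = ⟨x, y, z | r₁, r₂⟩. Then the abelianization of G is isomorphic to ℤ/4ℤ × ℤ × ℤ; more precisely, there is a group isomorphism from the abelianization of G to ℤ/4ℤ × ℤ × ℤ sending the class of x to (0, 1, 0), the class of y to (0, 0, 1), and the class of z to (−1, 1, 0). -/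
open LaurentPolynomial

/-- The relator set of the presentation `G = ⟨x, y, z | r₁, r₂⟩`. -/
def rels : Set F := {r₁, r₂}

/-- The images `(0,1,0)`, `(0,0,1)`, `(-1,1,0)` of `x`, `y`, `z` in `ℤ/4ℤ × ℤ × ℤ`. -/
def genImage : Fin 3 → Multiplicative (ZMod 4 × ℤ × ℤ) :=
  ![.ofAdd (0, 1, 0), .ofAdd (0, 0, 1), .ofAdd (-1, 1, 0)]

/-- Every relator vanishes on the images of the generators. -/
theorem lift_genImage_of_mem_rels : ∀ r ∈ rels, FreeGroup.lift genImage r = 1 := by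
  rintro r (rfl | rfl) <;>
    simp only [r₁, r₂, x, y, z, map_mul, map_inv, map_pow, FreeGroup.lift_apply_of, genImage] <;>
    decide

/-- The homomorphism from the abelianization of `G` to `ℤ/4ℤ × ℤ × ℤ`. -/
def abelianizationToProd :
    Abelianization (PresentedGroup rels) →* Multiplicative (ZMod 4 × ℤ × ℤ) :=
  Abelianization.lift (PresentedGroup.toGroup lift_genImage_of_mem_rels)

@[simp]
theorem abelianizationToProd_of (i : Fin 3) :
    abelianizationToProd (Abelianization.of (PresentedGroup.of i)) = genImage i := by
  simp [abelianizationToProd]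

/-- The class of the `i`-th generator in the abelianization of `G`. -/
def gen (i : Fin 3) : Abelianization (PresentedGroup rels) :=
  Abelianization.of (PresentedGroup.of i)

/-- The relator `r₁` makes the class of `xz⁻¹` a 4-torsion element. -/
theorem gen_zero_div_gen_two_pow_four : (gen 0 / gen 2) ^ 4 = 1 := by
  have h : Abelianization.of (PresentedGroup.mk rels r₁) = 1 := by
    rw [PresentedGroup.one_of_mem (by simp [rels]), map_one]
  simp only [r₁, x, y, z, map_mul, map_inv, map_pow] at h
  change (gen 2 ^ 2)⁻¹ * (gen 0)⁻¹ * ((gen 1)⁻¹ * gen 2 ^ 2 * gen 1 * (gen 0)⁻¹ * (gen 1)⁻¹ *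
    gen 2 ^ 2) ^ 2 * gen 1 * (gen 0)⁻¹ * (gen 2 ^ 2)⁻¹ * gen 1 = 1 at h
  rw [← inv_eq_one, ← h]
  apply Additive.ofMul.injective
  simp only [ofMul_mul, ofMul_inv, ofMul_pow, ofMul_div]
  abel

/-- The homomorphism from `ℤ/4ℤ × ℤ × ℤ` to the abelianization of `G` sending the standard
generators to the classes of `xz⁻¹`, `x`, `y`. -/
def prodToAbelianization :
    Multiplicative (ZMod 4 × ℤ × ℤ) →* Abelianization (PresentedGroup rels) :=
  AddMonoidHom.toMultiplicativeLeft <|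
    (ZMod.lift 4 ⟨zmultiplesHom _ (Additive.ofMul (gen 0 / gen 2)),
      congrArg Additive.ofMul gen_zero_div_gen_two_pow_four⟩).coprod
    ((zmultiplesHom _ (Additive.ofMul (gen 0))).coprod
      (zmultiplesHom _ (Additive.ofMul (gen 1))))

theorem prodToAbelianization_ofAdd (a b c : ℤ) :
    prodToAbelianization (.ofAdd ((a : ZMod 4), b, c)) =
      (gen 0 / gen 2) ^ a * (gen 0 ^ b * gen 1 ^ c) := by
  simp only [prodToAbelianization, AddMonoidHom.coe_toMultiplicativeLeft, Function.comp_apply,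
    toAdd_ofAdd, AddMonoidHom.coprod_apply, ZMod.lift_coe, zmultiplesHom_apply, toMul_add,
    toMul_zsmul, toMul_ofMul]

theorem prodToAbelianization_genImage (i : Fin 3) :
    prodToAbelianization (genImage i) = gen i := by
  fin_cases i
  · simpa [genImage] using prodToAbelianization_ofAdd 0 1 0
  · simpa [genImage] using prodToAbelianization_ofAdd 0 0 1
  · simpa [genImage] using prodToAbelianization_ofAdd (-1) 1 0

theorem prodToAbelianization_comp_abelianizationToProd :
    prodToAbelianization.comp abelianizationToProd = MonoidHom.id _ := by
  ext i
  simpa [gen] using prodToAbelianization_genImage i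

theorem abelianizationToProd_comp_prodToAbelianization :
    abelianizationToProd.comp prodToAbelianization = MonoidHom.id _ := by
  refine MonoidHom.ext fun p => ?_
  obtain ⟨a, b, c⟩ := p
  obtain ⟨a, rfl⟩ := ZMod.intCast_surjective a
  change abelianizationToProd (prodToAbelianization (.ofAdd ((a : ZMod 4), b, c))) =
    .ofAdd ((a : ZMod 4), b, c)
  rw [prodToAbelianization_ofAdd]
  simp only [gen, map_mul, map_div, map_zpow, abelianizationToProd_of]
  simp [genImage, ← ofAdd_zsmul, ← ofAdd_add, ← ofAdd_sub]

/-- the abelianization of `G = ⟨x, y, z | r₁, r₂⟩` is isomorphic to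
`ℤ/4ℤ × ℤ × ℤ`, by an isomorphism sending the class of `x` to `(0,1,0)`, the class of `y`
to `(0,0,1)`, and the class of `z` to `(-1,1,0)`. -/
theorem abelianization_of_G :
    ∃ e : Abelianization (PresentedGroup rels) ≃* Multiplicative (ZMod 4 × ℤ × ℤ),
      e (Abelianization.of (PresentedGroup.of (0 : Fin 3))) =
        Multiplicative.ofAdd ((0, 1, 0) : ZMod 4 × ℤ × ℤ) ∧
      e (Abelianization.of (PresentedGroup.of (1 : Fin 3))) =
        Multiplicative.ofAdd ((0, 0, 1) : ZMod 4 × ℤ × ℤ) ∧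
      e (Abelianization.of (PresentedGroup.of (2 : Fin 3))) =
        Multiplicative.ofAdd ((-1, 1, 0) : ZMod 4 × ℤ × ℤ) := by
  exact ⟨MonoidHom.toMulEquiv abelianizationToProd prodToAbelianization
    prodToAbelianization_comp_abelianizationToProd
    abelianizationToProd_comp_prodToAbelianization,
    abelianizationToProd_of 0, abelianizationToProd_of 1, abelianizationToProd_of 2⟩
end

section
/- Let F be the free group on x, y, z, let r₁ = z⁻²x⁻¹(y⁻¹z²yx⁻¹y⁻¹z²)²yx⁻¹z⁻²y and r₂ = z⁻²(yx⁻¹y⁻¹z²)²xz²x⁻¹(z⁻²yxy⁻¹)², let μ = z(yx⁻¹y⁻¹z²)²x, λ = x⁻¹(z⁻²yxy⁻¹)²(yx⁻¹y⁻¹z²)²xz², and for an integer k ≥ 0 set s_k = μλᵏ and G_k = ⟨x, y, z | r₁, r₂, s_k⟩. Then for every integer k ≥ 0 the abelianization of G_k is isomorphic to ℤ/(8k+16)ℤ × ℤ. -/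
open LaurentPolynomial

/-- The relator set of the presentation `G_k = ⟨x, y, z | r₁, r₂, s_k⟩`. -/
def relsK (k : ℕ) : Set F := {r₁, r₂, s k}

/-- The images of `x`, `y`, `z` in `ℤ/(8k+16)ℤ × ℤ`. -/
def generatorImage (k : ℕ) : Fin 3 → Multiplicative (ZMod (8 * k + 16) × ℤ) :=
  ![.ofAdd (2 * k + 5, 0), .ofAdd (0, 1), .ofAdd (1, 0)]

section CommGroup

variable {A : Type*} [CommGroup A] (φ : F →* A)

/-- In a commutative group, `r₁` is the relation `z⁴ = x⁴`. -/
lemma map_r₁ : φ r₁ = φ z ^ 4 * (φ x ^ 4)⁻¹ := by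
  simp only [r₁, map_mul, map_inv, map_pow]
  apply Additive.ofMul.injective
  simp only [ofMul_mul, ofMul_inv, ofMul_pow]
  module

/-- In a commutative group, `r₂` is the trivial relation. -/
lemma map_r₂ : φ r₂ = 1 := by
  simp only [r₂, map_mul, map_inv, map_pow]
  apply Additive.ofMul.injective
  simp only [ofMul_mul, ofMul_inv, ofMul_pow, ofMul_one]
  module

/-- In a commutative group, `s k` is the relation `x = z ^ (2k + 5)`. -/
lemma map_s (k : ℕ) : φ (s k) = φ z ^ (2 * k + 5) * (φ x)⁻¹ := by
  simp only [s, μ, lam, map_mul, map_inv, map_pow]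
  apply Additive.ofMul.injective
  simp only [ofMul_mul, ofMul_inv, ofMul_pow]
  module

end CommGroup

lemma lift_generatorImage_eq_one (k : ℕ) :
    ∀ r ∈ relsK k, FreeGroup.lift (generatorImage k) r = 1 := by
  have hn : (8 * k + 16 : ZMod (8 * k + 16)) = 0 := by
    exact_mod_cast ZMod.natCast_self (8 * k + 16)
  rintro r (rfl | rfl | rfl)
  · rw [map_r₁]
    apply Multiplicative.toAdd.injective
    simp only [x, z, FreeGroup.lift_apply_of, generatorImage]
    ext
    · simp
      linear_combination -hn
    · simp
  · exact map_r₂ _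
  · rw [map_s]
    apply Multiplicative.toAdd.injective
    simp only [x, z, FreeGroup.lift_apply_of, generatorImage]
    ext <;> simp

/-- The map from the abelianization of `G_k` to `ℤ/(8k+16)ℤ × ℤ`. -/
def abelianizationHom (k : ℕ) :
    Abelianization (PresentedGroup (relsK k)) →* Multiplicative (ZMod (8 * k + 16) × ℤ) :=
  Abelianization.lift (PresentedGroup.toGroup (lift_generatorImage_eq_one k))

/-- The projection of the free group onto the abelianization of `G_k`. -/
def toAbelianization (k : ℕ) : F →* Abelianization (PresentedGroup (relsK k)) :=
  Abelianization.of.comp (PresentedGroup.mk (relsK k))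

lemma toAbelianization_eq_one (k : ℕ) {r : F} (hr : r ∈ relsK k) :
    toAbelianization k r = 1 := by
  simp [toAbelianization, PresentedGroup.one_of_mem hr]

lemma toAbelianization_x (k : ℕ) :
    toAbelianization k x = toAbelianization k z ^ (2 * k + 5) := by
  have h := toAbelianization_eq_one k (r := s k) (by simp [relsK])
  rw [map_s, mul_inv_eq_one] at h
  exact h.symm

lemma toAbelianization_z_pow (k : ℕ) : toAbelianization k z ^ (8 * k + 16) = 1 := by
  have h := toAbelianization_eq_one k (r := r₁) (by simp [relsK])
  rw [map_r₁, mul_inv_eq_one, toAbelianization_x, ← pow_mul,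
    show (2 * k + 5) * 4 = 4 + (8 * k + 16) by ring, pow_add] at h
  exact left_eq_mul.mp h

/-- The map from `ℤ/(8k+16)ℤ × ℤ` sending the two generators to `z` and `y`. -/
def abelianizationInv (k : ℕ) :
    Multiplicative (ZMod (8 * k + 16) × ℤ) →* Abelianization (PresentedGroup (relsK k)) :=
  AddMonoidHom.toMultiplicativeLeft <|
    (ZMod.lift (8 * k + 16) ⟨zmultiplesHom _ (Additive.ofMul (toAbelianization k z)), by
      rw [zmultiplesHom_apply, natCast_zsmul, ← ofMul_pow, toAbelianization_z_pow,
        ofMul_one]⟩).coprod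
    (zmultiplesHom _ (Additive.ofMul (toAbelianization k y)))

lemma abelianizationHom_toAbelianization (k : ℕ) (i : Fin 3) :
    abelianizationHom k (toAbelianization k (FreeGroup.of i)) = generatorImage k i := by
  simp only [abelianizationHom, toAbelianization, MonoidHom.comp_apply, Abelianization.lift_apply_of]
  exact PresentedGroup.toGroup.of _

lemma abelianizationInv_ofAdd (k : ℕ) (a b : ℤ) :
    abelianizationInv k (.ofAdd ((a : ZMod (8 * k + 16)), b)) =
      toAbelianization k z ^ a * toAbelianization k y ^ b := by
  simp [abelianizationInv]

/-- for every integer `k ≥ 0` the abelianization of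
`G_k = ⟨x, y, z | r₁, r₂, s_k⟩` is isomorphic to `ℤ/(8k+16)ℤ × ℤ`. -/
theorem abelianization_of_Gk (k : ℕ) :
    Nonempty (Abelianization (PresentedGroup (relsK k)) ≃*
      Multiplicative (ZMod (8 * k + 16) × ℤ)) := by
  refine ⟨(abelianizationHom k).toMulEquiv (abelianizationInv k) ?_ ?_⟩
  · ext i
    change abelianizationInv k (abelianizationHom k (toAbelianization k (.of i))) =
      toAbelianization k (.of i)
    rw [abelianizationHom_toAbelianization]
    fin_cases i
    · have h := abelianizationInv_ofAdd k (2 * k + 5) 0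
      rw [zpow_zero, mul_one] at h
      push_cast at h
      exact h.trans ((zpow_natCast _ (2 * k + 5)).trans (toAbelianization_x k).symm)
    · simpa [generatorImage, y] using abelianizationInv_ofAdd k 0 1
    · simpa [generatorImage, z] using abelianizationInv_ofAdd k 1 0
  · refine MonoidHom.ext fun g => ?_
    obtain ⟨⟨c, b⟩, rfl⟩ := Multiplicative.ofAdd.surjective g
    obtain ⟨a, rfl⟩ := ZMod.intCast_surjective c
    rw [MonoidHom.comp_apply, abelianizationInv_ofAdd, map_mul, map_zpow, map_zpow, y, z,
      abelianizationHom_toAbelianization, abelianizationHom_toAbelianization]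
    apply Multiplicative.toAdd.injective
    ext <;> simp [generatorImage]
end

section
/- Let F be the free group on x, y, z, let r₁ = z⁻²x⁻¹(y⁻¹z²yx⁻¹y⁻¹z²)²yx⁻¹z⁻²y and r₂ = z⁻²(yx⁻¹y⁻¹z²)²xz²x⁻¹(z⁻²yxy⁻¹)², let μ = z(yx⁻¹y⁻¹z²)²x, λ = x⁻¹(z⁻²yxy⁻¹)²(yx⁻¹y⁻¹z²)²xz², and for an integer k ≥ 0 set s_k = μλᵏ and G_k = ⟨x, y, z | r₁, r₂, s_k⟩. Then for every integer k ≥ 0: (1) the quotient of the abelianization of G_k by its torsion subgroup is an infinite cyclic group; (2) the images of x and z in the abelianization of G_k are torsion elements, and the image of y has infinite order and generates the quotient of the abelianization of G_k by its torsion subgroup. -/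
open LaurentPolynomial

/-- The class of a generator in the abelianization of `G_k`. -/
abbrev abGen (k : ℕ) (i : Fin 3) : Abelianization (PresentedGroup (relsK k)) :=
  Abelianization.of (PresentedGroup.of i)

/-- The composite of the projection `F → G_k` with abelianization. -/
def freeToAb (k : ℕ) : F →* Abelianization (PresentedGroup (relsK k)) :=
  Abelianization.of.comp (PresentedGroup.mk (relsK k))

lemma freeToAb_of (k : ℕ) (i : Fin 3) : freeToAb k (FreeGroup.of i) = abGen k i := rfl

lemma freeToAb_eq_one {k : ℕ} {r : F} (hr : r ∈ relsK k) : freeToAb k r = 1 := by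
  have h : PresentedGroup.mk (relsK k) r = 1 := PresentedGroup.one_of_mem hr
  simp [freeToAb, h]

lemma abGen_two_pow_four (k : ℕ) : abGen k 2 ^ 4 = abGen k 0 ^ 4 := by
  have h : freeToAb k r₁ = 1 := freeToAb_eq_one (by simp [relsK])
  simp only [r₁, x, y, z, map_mul, map_inv, map_pow, freeToAb_of] at h
  generalize abGen k 0 = a at *
  generalize abGen k 1 = b at *
  generalize abGen k 2 = c at *
  rw [← div_eq_one, ← h]
  apply Additive.ofMul.injective
  simp only [ofMul_mul, ofMul_inv, ofMul_pow, ofMul_div]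
  abel

lemma abGen_zero_eq (k : ℕ) : abGen k 0 = abGen k 2 ^ (5 + 2 * k) := by
  have h : freeToAb k (s k) = 1 := freeToAb_eq_one (by simp [relsK])
  have hlam : freeToAb k lam = abGen k 2 ^ 2 := by
    simp only [lam, x, y, z, map_mul, map_inv, map_pow, freeToAb_of]
    generalize abGen k 0 = a
    generalize abGen k 1 = b
    generalize abGen k 2 = c
    apply Additive.ofMul.injective
    simp only [ofMul_mul, ofMul_inv, ofMul_pow]
    abel
  have hmu : freeToAb k μ = abGen k 2 ^ 5 * (abGen k 0)⁻¹ := by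
    simp only [μ, x, y, z, map_mul, map_inv, map_pow, freeToAb_of]
    generalize abGen k 0 = a
    generalize abGen k 1 = b
    generalize abGen k 2 = c
    apply Additive.ofMul.injective
    simp only [ofMul_mul, ofMul_inv, ofMul_pow]
    abel
  rw [s, map_mul, map_pow, hlam, hmu, mul_right_comm, mul_inv_eq_one, ← pow_mul, ← pow_add] at h
  exact h.symm

lemma isOfFinOrder_abGen_two (k : ℕ) : IsOfFinOrder (abGen k 2) := by
  refine isOfFinOrder_iff_pow_eq_one.mpr ⟨16 + 8 * k, by lia, ?_⟩
  have h := abGen_two_pow_four k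
  rw [abGen_zero_eq, ← pow_mul, show (5 + 2 * k) * 4 = 4 + (16 + 8 * k) by ring, pow_add] at h
  exact left_eq_mul.mp h

lemma isOfFinOrder_abGen_zero (k : ℕ) : IsOfFinOrder (abGen k 0) := by
  rw [abGen_zero_eq]
  exact (isOfFinOrder_abGen_two k).pow

/-- The exponent sum of `y`, as a homomorphism on the abelianization of `G_k`. -/
def yExponent (k : ℕ) : Abelianization (PresentedGroup (relsK k)) →* Multiplicative ℤ :=
  Abelianization.lift (PresentedGroup.toGroup
    (f := ![1, Multiplicative.ofAdd 1, 1]) (by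
      rintro r (rfl | rfl | rfl) <;> simp [r₁, r₂, s, μ, lam, x, y, z, pow_two, mul_assoc]))

lemma yExponent_abGen (k : ℕ) (i : Fin 3) :
    yExponent k (abGen k i) = ![1, Multiplicative.ofAdd 1, 1] i := by
  simp [yExponent, abGen]

lemma torsion_le_ker_yExponent (k : ℕ) :
    CommGroup.torsion (Abelianization (PresentedGroup (relsK k))) ≤ (yExponent k).ker :=
  fun _ ha => (isOfFinOrder_iff_eq_one _).mp ((yExponent k).isOfFinOrder ha)

/-- The quotient of the abelianization of `G_k` by its torsion subgroup is infinite cyclic,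
with the class of `y` corresponding to `1`. -/
def abModTorsionEquiv (k : ℕ) :
    (Abelianization (PresentedGroup (relsK k)) ⧸
      CommGroup.torsion (Abelianization (PresentedGroup (relsK k)))) ≃* Multiplicative ℤ :=
  MonoidHom.toMulEquiv
    (QuotientGroup.lift _ (yExponent k) (torsion_le_ker_yExponent k))
    (zpowersHom _ (QuotientGroup.mk (abGen k 1)))
    (by
      ext i
      have h : zpowersHom _ (QuotientGroup.mk (abGen k 1)) (yExponent k (abGen k i)) =
          (QuotientGroup.mk (abGen k i) : _ ⧸ CommGroup.torsion _) := by
        rw [yExponent_abGen]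
        fin_cases i
        · simpa using ((QuotientGroup.eq_one_iff _).mpr (isOfFinOrder_abGen_zero k)).symm
        · simp
        · simpa using ((QuotientGroup.eq_one_iff _).mpr (isOfFinOrder_abGen_two k)).symm
      exact h)
    (by
      ext
      simp [yExponent_abGen])

lemma abModTorsionEquiv_mk_abGen_one (k : ℕ) :
    abModTorsionEquiv k (QuotientGroup.mk (abGen k 1)) = Multiplicative.ofAdd 1 :=
  yExponent_abGen k 1

/-- for every integer `k ≥ 0`:
(1) the quotient of the abelianization of `G_k` by its torsion subgroup is an infinite
cyclic group (isomorphic to `ℤ`);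
(2) the images of `x` and `z` in the abelianization of `G_k` are torsion elements, the
image of `y` has infinite order, and the image of `y` generates the quotient of the
abelianization of `G_k` by its torsion subgroup. -/
theorem Hk_infinite_cyclic_generated_by_y (k : ℕ) :
    Nonempty ((Abelianization (PresentedGroup (relsK k)) ⧸
        CommGroup.torsion (Abelianization (PresentedGroup (relsK k)))) ≃* Multiplicative ℤ) ∧
    IsOfFinOrder
      (Abelianization.of (PresentedGroup.of (0 : Fin 3) : PresentedGroup (relsK k))) ∧
    IsOfFinOrder
      (Abelianization.of (PresentedGroup.of (2 : Fin 3) : PresentedGroup (relsK k))) ∧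
    ¬ IsOfFinOrder
      (Abelianization.of (PresentedGroup.of (1 : Fin 3) : PresentedGroup (relsK k))) ∧
    Subgroup.zpowers
      ((QuotientGroup.mk
          (Abelianization.of (PresentedGroup.of (1 : Fin 3) : PresentedGroup (relsK k)))) :
        Abelianization (PresentedGroup (relsK k)) ⧸
          CommGroup.torsion (Abelianization (PresentedGroup (relsK k)))) = ⊤ := by
  refine ⟨⟨abModTorsionEquiv k⟩, isOfFinOrder_abGen_zero k, isOfFinOrder_abGen_two k, ?_, ?_⟩
  · intro h
    have h1 := torsion_le_ker_yExponent k h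
    rw [MonoidHom.mem_ker, yExponent_abGen] at h1
    exact one_ne_zero (Multiplicative.ofAdd.injective h1)
  · refine (Subgroup.eq_top_iff' _).mpr fun q => Subgroup.mem_zpowers_iff.mpr
      ⟨Multiplicative.toAdd (abModTorsionEquiv k q), (abModTorsionEquiv k).injective ?_⟩
    rw [map_zpow, abModTorsionEquiv_mk_abGen_one, ← ofAdd_zsmul]
    simp
end

section
/- Let P be the presented group on thirteen generators g₁, g₂, g₃, g₅, g₇, g₉, g₁₀, g₁₃, g₁₆, g₁₈, g₁₉, g₂₁, g₂₂ with the twelve relators g₇⁻¹g₁⁻¹g₉, g₂⁻¹g₁₀⁻¹g₉, g₁⁻¹g₂⁻¹g₁⁻¹g₃, g₃⁻¹g₇⁻¹g₅, g₁₃⁻¹g₅⁻¹g₃⁻¹g₂⁻¹g₇, g₅⁻¹g₁₆g₁₀, g₉⁻¹g₁₃⁻¹g₁₀, g₁₃⁻¹g₁₉g₁₆, g₁₆⁻¹g₁₈, g₁₈⁻¹g₁₉⁻¹g₂₂g₂₁, g₁₉⁻¹g₁₈⁻¹g₂₁g₂₂, g₂₁⁻¹g₂₂. Let G = ⟨x,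 y, z | r₁, r₂⟩ with r₁ = z⁻²x⁻¹(y⁻¹z²yx⁻¹y⁻¹z²)²yx⁻¹z⁻²y and r₂ = z⁻²(yx⁻¹y⁻¹z²)²xz²x⁻¹(z⁻²yxy⁻¹)². Then the assignment g₁ ↦ x, g₂ ↦ y⁻¹z⁻²y, g₃ ↦ xy⁻¹z⁻²yx, g₅ ↦ x⁻¹z⁻²yxy⁻¹z⁻²yx, g₇ ↦ x⁻¹z⁻²y, g₉ ↦ z⁻²y, g₁₀ ↦ y, g₁₃ ↦ z², g₁₆ ↦ x⁻¹(z⁻²yxy⁻¹)², g₁₈ ↦ x⁻¹(z⁻²yxy⁻¹)², g₁₉ ↦ (yx⁻¹y⁻¹z²)²xz², g₂₁ ↦ z, g₂₂ ↦ z defines a group isomorphism P ≅ G. -/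
open LaurentPolynomial

/-- The free group on the thirteen generators
`g₁, g₂, g₃, g₅, g₇, g₉, g₁₀, g₁₃, g₁₆, g₁₈, g₁₉, g₂₁, g₂₂`,
indexed in this order by `0, 1, ..., 12`. -/
abbrev F13 : Type := FreeGroup (Fin 13)

/-- `g 0 = g₁`, `g 1 = g₂`, `g 2 = g₃`, `g 3 = g₅`, `g 4 = g₇`, `g 5 = g₉`, `g 6 = g₁₀`,
`g 7 = g₁₃`, `g 8 = g₁₆`, `g 9 = g₁₈`, `g 10 = g₁₉`, `g 11 = g₂₁`, `g 12 = g₂₂`. -/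
def g (i : Fin 13) : F13 := FreeGroup.of i

/-- The twelve relators of the presentation `P`. -/
def Prels : Set F13 :=
  { (g 4)⁻¹ * (g 0)⁻¹ * g 5,                       -- g₇⁻¹g₁⁻¹g₉
    (g 1)⁻¹ * (g 6)⁻¹ * g 5,                       -- g₂⁻¹g₁₀⁻¹g₉
    (g 0)⁻¹ * (g 1)⁻¹ * (g 0)⁻¹ * g 2,             -- g₁⁻¹g₂⁻¹g₁⁻¹g₃
    (g 2)⁻¹ * (g 4)⁻¹ * g 3,                       -- g₃⁻¹g₇⁻¹g₅
    (g 7)⁻¹ * (g 3)⁻¹ * (g 2)⁻¹ * (g 1)⁻¹ * g 4,   -- g₁₃⁻¹g₅⁻¹g₃⁻¹g₂⁻¹g₇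
    (g 3)⁻¹ * g 8 * g 6,                           -- g₅⁻¹g₁₆g₁₀
    (g 5)⁻¹ * (g 7)⁻¹ * g 6,                       -- g₉⁻¹g₁₃⁻¹g₁₀
    (g 7)⁻¹ * g 10 * g 8,                          -- g₁₃⁻¹g₁₉g₁₆
    (g 8)⁻¹ * g 9,                                 -- g₁₆⁻¹g₁₈
    (g 9)⁻¹ * (g 10)⁻¹ * g 12 * g 11,              -- g₁₈⁻¹g₁₉⁻¹g₂₂g₂₁
    (g 10)⁻¹ * (g 9)⁻¹ * g 11 * g 12,              -- g₁₉⁻¹g₁₈⁻¹g₂₁g₂₂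
    (g 11)⁻¹ * g 12 }                              -- g₂₁⁻¹g₂₂

/-- The images in `G` of the generators `x`, `y`, `z`. -/
def X : PresentedGroup rels := PresentedGroup.of (0 : Fin 3)
def Y : PresentedGroup rels := PresentedGroup.of (1 : Fin 3)
def Z : PresentedGroup rels := PresentedGroup.of (2 : Fin 3)

/-- The images of the thirteen generators of `P` under the simplification isomorphism:
`g₁ ↦ x`, `g₂ ↦ y⁻¹z⁻²y`, `g₃ ↦ xy⁻¹z⁻²yx`, `g₅ ↦ x⁻¹z⁻²yxy⁻¹z⁻²yx`, `g₇ ↦ x⁻¹z⁻²y`,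
`g₉ ↦ z⁻²y`, `g₁₀ ↦ y`, `g₁₃ ↦ z²`, `g₁₆ ↦ x⁻¹(z⁻²yxy⁻¹)²`, `g₁₈ ↦ x⁻¹(z⁻²yxy⁻¹)²`,
`g₁₉ ↦ (yx⁻¹y⁻¹z²)²xz²`, `g₂₁ ↦ z`, `g₂₂ ↦ z`. -/
def w : Fin 13 → PresentedGroup rels :=
  ![X,
    Y⁻¹ * (Z ^ 2)⁻¹ * Y,
    X * Y⁻¹ * (Z ^ 2)⁻¹ * Y * X,
    X⁻¹ * (Z ^ 2)⁻¹ * Y * X * Y⁻¹ * (Z ^ 2)⁻¹ * Y * X,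
    X⁻¹ * (Z ^ 2)⁻¹ * Y,
    (Z ^ 2)⁻¹ * Y,
    Y,
    Z ^ 2,
    X⁻¹ * ((Z ^ 2)⁻¹ * Y * X * Y⁻¹) ^ 2,
    X⁻¹ * ((Z ^ 2)⁻¹ * Y * X * Y⁻¹) ^ 2,
    (Y * X⁻¹ * Y⁻¹ * Z ^ 2) ^ 2 * X * Z ^ 2,
    Z,
    Z]

/-- The generators of a presented group satisfy its relations. -/
theorem lift_of_eq_one {α : Type*} {R : Set (FreeGroup α)} (r : FreeGroup α) (hr : r ∈ R) :
    FreeGroup.lift (PresentedGroup.of (rels := R)) r = 1 := by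
  have h : FreeGroup.lift (PresentedGroup.of (rels := R)) = PresentedGroup.mk R := by
    ext i
    rfl
  rw [h]
  exact PresentedGroup.one_of_mem hr

/-- The images `w i` satisfy the twelve relations of `P`. -/
theorem lift_w_eq_one (r : F13) (hr : r ∈ Prels) : FreeGroup.lift w r = 1 := by
  have h₁ := lift_of_eq_one (R := rels) r₁ (Or.inl rfl)
  have h₂ := lift_of_eq_one (R := rels) r₂ (Or.inr rfl)
  simp only [r₁, r₂, x, y, z, map_mul, map_inv, map_pow, FreeGroup.lift_apply_of] at h₁ h₂
  simp only [← X.eq_def, ← Y.eq_def, ← Z.eq_def] at h₁ h₂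
  simp only [Prels, Set.mem_insert_iff, Set.mem_singleton_iff] at hr
  rcases hr with rfl | rfl | rfl | rfl | rfl | rfl | rfl | rfl | rfl | rfl | rfl | rfl <;>
    simp only [g, w, map_mul, map_inv, FreeGroup.lift_apply_of, Matrix.cons_val]
  case inr.inr.inr.inr.inl => rw [← h₁]; simp [pow_two, mul_assoc]
  case inr.inr.inr.inr.inr.inr.inr.inl => rw [← h₂]; simp [pow_two, mul_assoc]
  case inr.inr.inr.inr.inr.inr.inr.inr.inr.inl =>
    rw [← mul_inv_rev, mul_assoc, inv_mul_eq_one, ← pow_two, eq_comm, ← inv_mul_eq_one, ← h₂]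
    simp [pow_two, mul_assoc]
  all_goals simp [pow_two, mul_assoc]

/-- In any group, the relations of `P` express all thirteen generators through
`g₁`, `g₁₀` and `g₂₁`. -/
theorem generators_eq_of_relations {H : Type*} [Group H] (h : Fin 13 → H)
    (hh : ∀ r ∈ Prels, FreeGroup.lift h r = 1) :
    h = ![h 0,
      (h 6)⁻¹ * (h 11 ^ 2)⁻¹ * h 6,
      h 0 * (h 6)⁻¹ * (h 11 ^ 2)⁻¹ * h 6 * h 0,
      (h 0)⁻¹ * (h 11 ^ 2)⁻¹ * h 6 * h 0 * (h 6)⁻¹ * (h 11 ^ 2)⁻¹ * h 6 * h 0,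
      (h 0)⁻¹ * (h 11 ^ 2)⁻¹ * h 6,
      (h 11 ^ 2)⁻¹ * h 6,
      h 6,
      h 11 ^ 2,
      (h 0)⁻¹ * ((h 11 ^ 2)⁻¹ * h 6 * h 0 * (h 6)⁻¹) ^ 2,
      (h 0)⁻¹ * ((h 11 ^ 2)⁻¹ * h 6 * h 0 * (h 6)⁻¹) ^ 2,
      (h 6 * (h 0)⁻¹ * (h 6)⁻¹ * h 11 ^ 2) ^ 2 * h 0 * h 11 ^ 2,
      h 11,
      h 11] := by
  simp only [Prels, g, Set.mem_insert_iff, Set.mem_singleton_iff, forall_eq_or_imp, forall_eq,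
    map_mul, map_inv, FreeGroup.lift_apply_of] at hh
  obtain ⟨r974, r926, r3, r5, -, r16, r913, r19, r18, r2221, r2122, r22⟩ := hh
  have e12 : h 12 = h 11 := (inv_mul_eq_one.mp r22).symm
  have e9 : h 9 = h 8 := (inv_mul_eq_one.mp r18).symm
  rw [e12, e9] at r2221 r2122
  have e7 : h 7 = h 11 ^ 2 := by
    rw [mul_assoc, inv_mul_eq_one] at r19
    rw [← mul_inv_rev, mul_assoc, inv_mul_eq_one] at r2221
    rw [r19, r2221, pow_two]
  have e5 : h 5 = (h 11 ^ 2)⁻¹ * h 6 := by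
    rw [mul_assoc, inv_mul_eq_one, e7] at r913
    exact r913
  have e4 : h 4 = (h 0)⁻¹ * (h 11 ^ 2)⁻¹ * h 6 := by
    rw [mul_assoc, inv_mul_eq_one, e5] at r974
    rw [r974, mul_assoc]
  have e1 : h 1 = (h 6)⁻¹ * (h 11 ^ 2)⁻¹ * h 6 := by
    rw [mul_assoc, inv_mul_eq_one, e5] at r926
    rw [r926, mul_assoc]
  have e2 : h 2 = h 0 * (h 6)⁻¹ * (h 11 ^ 2)⁻¹ * h 6 * h 0 := by
    rw [← mul_inv_rev, ← mul_inv_rev, inv_mul_eq_one, e1] at r3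
    rw [← r3]; simp [pow_two, mul_assoc]
  have e3 : h 3 = (h 0)⁻¹ * (h 11 ^ 2)⁻¹ * h 6 * h 0 * (h 6)⁻¹ * (h 11 ^ 2)⁻¹ * h 6 * h 0 := by
    rw [← mul_inv_rev, inv_mul_eq_one, e4, e2] at r5
    rw [← r5]; simp [pow_two, mul_assoc]
  have e8 : h 8 = (h 0)⁻¹ * ((h 11 ^ 2)⁻¹ * h 6 * h 0 * (h 6)⁻¹) ^ 2 := by
    rw [mul_assoc, inv_mul_eq_one, ← mul_inv_eq_iff_eq_mul, e3] at r16
    rw [← r16]; simp [pow_two, mul_assoc]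
  have e10 : h 10 = (h 6 * (h 0)⁻¹ * (h 6)⁻¹ * h 11 ^ 2) ^ 2 * h 0 * h 11 ^ 2 := by
    rw [← mul_inv_rev, mul_assoc, inv_mul_eq_one, ← eq_inv_mul_iff_mul_eq, e8] at r2122
    rw [r2122]; simp [pow_two, mul_assoc]
  funext i
  fin_cases i
  exacts [rfl, e1, e2, e3, e4, e5, rfl, e7, e8, e9.trans e8, e10, rfl, e12]

/-- In any group, elements satisfying the relations of `P` satisfy those of `G`
at `g₁`, `g₁₀`, `g₂₁`. -/
theorem lift_rels_eq_one_of_relations {H : Type*} [Group H] (h : Fin 13 → H)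
    (hh : ∀ r ∈ Prels, FreeGroup.lift h r = 1) (r : F) (hr : r ∈ rels) :
    FreeGroup.lift ![h 0, h 6, h 11] r = 1 := by
  have hw := generators_eq_of_relations h hh
  simp only [Prels, g, Set.mem_insert_iff, Set.mem_singleton_iff, forall_eq_or_imp, forall_eq,
    map_mul, map_inv, FreeGroup.lift_apply_of] at hh
  obtain ⟨-, -, -, -, h₁, -, -, h₂, -⟩ := hh
  rw [congrFun hw 7, congrFun hw 3, congrFun hw 2, congrFun hw 1, congrFun hw 4] at h₁
  rw [congrFun hw 7, congrFun hw 10, congrFun hw 8] at h₂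
  simp only [Matrix.cons_val] at h₁ h₂
  rcases hr with rfl | rfl
  · simp only [r₁, x, y, z, map_mul, map_inv, map_pow, FreeGroup.lift_apply_of, Matrix.cons_val]
    rw [← h₁]; simp [pow_two, mul_assoc]
  · simp only [r₂, x, y, z, map_mul, map_inv, map_pow, FreeGroup.lift_apply_of, Matrix.cons_val]
    rw [← h₂]; simp [pow_two, mul_assoc]

/-- the assignment `g i ↦ w i` defines a group isomorphism `P ≅ G`. -/
theorem presentation_simplification :
    ∃ e : PresentedGroup Prels ≃* PresentedGroup rels,
      ∀ i : Fin 13, e (PresentedGroup.of i) = w i := by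
  let f : PresentedGroup Prels →* PresentedGroup rels := PresentedGroup.toGroup lift_w_eq_one
  let k : PresentedGroup rels →* PresentedGroup Prels :=
    PresentedGroup.toGroup (lift_rels_eq_one_of_relations _ lift_of_eq_one)
  have hf (i : Fin 13) : f (PresentedGroup.of i) = w i := PresentedGroup.toGroup.of _
  have hX : k X = PresentedGroup.of 0 := PresentedGroup.toGroup.of _
  have hY : k Y = PresentedGroup.of 6 := PresentedGroup.toGroup.of _
  have hZ : k Z = PresentedGroup.of 11 := PresentedGroup.toGroup.of _
  have hkf : k.comp f = MonoidHom.id _ := by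
    ext i
    rw [MonoidHom.comp_apply, hf, MonoidHom.id_apply,
      congrFun (generators_eq_of_relations _ lift_of_eq_one) i]
    fin_cases i <;> simp [w, hX, hY, hZ]
  have hfk : f.comp k = MonoidHom.id _ := by
    ext i
    fin_cases i
    · exact (congrArg f hX).trans (hf 0)
    · exact (congrArg f hY).trans (hf 6)
    · exact (congrArg f hZ).trans (hf 11)
  exact ⟨MonoidHom.toMulEquiv f k hkf hfk, hf⟩
end

section
/- Let D₀ be the 8×16 matrix over the Laurent polynomial ring ℤ[a, a⁻¹] with columns indexed f₀, …, f₁₅ and rows: row 1 = (−a, −a, 0, 0, 0, 0, 0, 1, −a, 1, 0, 0, 0, 0, 0, 0); row 2 = (1, 0, 1, 0, −1, 0, −1, 0, 0, −1, −1, 0, −a, 0, 0, 0); row 3 = (0, 0, −1, −1, 1, 0, 0, 0, 0, 0, 0, 0, 0, 0, 0, 0); row 4 = (−1, 0, 0, 1, −a, −1, 1, −1, 0, 0, 0, 0, 0, 0, 0, 0); row 5 = (0, 0, −a, −a, 0, −1, 0, −1, 1, 0, 0, −1, 0, 1, 0, 0); row 6 = (0, 0, 0, 0, 0, 1, −a,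 0, 0, 0, 1, −a, 0, 0, −a, 0); row 7 = (0, 0, 0, 0, 0, 0, 0, 0, −1, −1, −1, 1, −1, −a, 0, 1−a); row 8 = (0, 0, 0, 0, 0, 0, 0, 0, 0, 0, 0, 0, 1, −1, 0, −1). Let D_{Y₀} be the 8×9 submatrix of D₀ consisting of the columns f₁, f₂, f₃, f₅, f₇, f₉, f₁₀, f₁₃, f₁₄ (i.e. D₀ with the columns f₀, f₄, f₆, f₈, f₁₁, f₁₂, f₁₅ deleted). Then every 8×8 minor of D_{Y₀} is equal to zero; equivalently, the greatest common divisor of the maximal minors of D_{Y₀} is 0. -/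
open LaurentPolynomial

/-- The generator `a` of the Laurent polynomial ring `ℤ[a, a⁻¹]`. -/
noncomputable def a : LaurentPolynomial ℤ := T 1

/-- The full branch relations matrix `D₀` of the veering triangulation `V₀`, an 8×16
matrix over `ℤ[a, a⁻¹]` with columns indexed by the faces `f₀, …, f₁₅`. -/
noncomputable def D₀ : Matrix (Fin 8) (Fin 16) (LaurentPolynomial ℤ) :=
  !![-a, -a,  0,  0,  0,  0,  0,  1, -a,  1,  0,  0,  0,  0,  0,  0;
      1,  0,  1,  0, -1,  0, -1,  0,  0, -1, -1,  0, -a,  0,  0,  0;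
      0,  0, -1, -1,  1,  0,  0,  0,  0,  0,  0,  0,  0,  0,  0,  0;
     -1,  0,  0,  1, -a, -1,  1, -1,  0,  0,  0,  0,  0,  0,  0,  0;
      0,  0, -a, -a,  0, -1,  0, -1,  1,  0,  0, -1,  0,  1,  0,  0;
      0,  0,  0,  0,  0,  1, -a,  0,  0,  0,  1, -a,  0,  0, -a,  0;
      0,  0,  0,  0,  0,  0,  0,  0, -1, -1, -1,  1, -1, -a,  0,  1 - a;
      0,  0,  0,  0,  0,  0,  0,  0,  0,  0,  0,  0,  1, -1,  0, -1]

/-- The branch relations matrix reduced modulo the spanning tree `Y₀`: the 8×9 submatrix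
of `D₀` consisting of the columns `f₁, f₂, f₃, f₅, f₇, f₉, f₁₀, f₁₃, f₁₄`. -/
noncomputable def DY₀ : Matrix (Fin 8) (Fin 9) (LaurentPolynomial ℤ) :=
  D₀.submatrix id ![1, 2, 3, 5, 7, 9, 10, 13, 14]

/-- A nonzero vector in the left kernel of `DY₀`. -/
noncomputable def leftKernelVector : Fin 8 → LaurentPolynomial ℤ :=
  ![0, 1, 1 + a, 1, -1, 0, -1, a - 1]

theorem leftKernelVector_vecMul_DY₀ : Matrix.vecMul leftKernelVector DY₀ = 0 := by
  ext1 j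
  fin_cases j <;>
    simp [leftKernelVector, DY₀, D₀, Matrix.vecMul, dotProduct, Fin.sum_univ_succ]

theorem leftKernelVector_ne_zero : leftKernelVector ≠ 0 := fun h =>
  one_ne_zero (congrFun h 1)

/-- every 8×8 minor of `D_{Y₀}` is equal to zero (equivalently, the greatest
common divisor of the maximal minors of `D_{Y₀}` is 0). -/
theorem maximal_minors_vanish :
    ∀ cols : Fin 8 → Fin 9, (DY₀.submatrix id cols).det = 0 := by
  intro cols
  refine Matrix.exists_vecMul_eq_zero_iff.mp ⟨leftKernelVector, leftKernelVector_ne_zero, ?_⟩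
  ext1 j
  exact congrFun leftKernelVector_vecMul_DY₀ (cols j)
end
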